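/- arXiv:2601.20733 — 2 statements merged into one kernel-verified Lean document; each statement's English description precedes it below -/
import Mathlib

section
/- For every k ∈ (0,1): K(k)² · √(k⁴ − k² + 1) > π²/4, where K(k) = ∫₀^{π/2} (1 − k² sin²θ)^{−1/2} dθ is the complete elliptic integral of the first kind. -/
open Real

/-- The complete elliptic integral of the first kind. -/
noncomputable def ellipticK (k : ℝ) : ℝ :=
  ∫ θ in (0 : ℝ)..(π / 2), 1 / Real.sqrt (1 - k ^ 2 * Real.sin θ ^ 2)

theorem ellipticK_lower (k : ℝ) (hk0 : 0 < k) (hk1 : k < 1) :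
    π / 2 * (1 + k ^ 2 / 4) ≤ ellipticK k := by
  have hk2 : k ^ 2 < 1 := by nlinarith
  have hpos : ∀ θ : ℝ, 0 < 1 - k ^ 2 * Real.sin θ ^ 2 := fun θ => by
    nlinarith [Real.sin_sq_le_one θ, sq_nonneg (Real.sin θ), sq_nonneg k]
  have hI : ∫ θ in (0 : ℝ)..(π / 2), (1 + k ^ 2 / 2 * Real.sin θ ^ 2)
      = π / 2 * (1 + k ^ 2 / 4) := by
    rw [intervalIntegral.integral_add (Continuous.intervalIntegrable (by fun_prop) _ _)
      (Continuous.intervalIntegrable (by fun_prop) _ _),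
      intervalIntegral.integral_const_mul, integral_sin_sq]
    simp
    ring
  rw [← hI]
  unfold ellipticK
  apply intervalIntegral.integral_mono_on (by positivity)
  · exact Continuous.intervalIntegrable (by fun_prop) _ _
  · apply Continuous.intervalIntegrable
    exact continuous_const.div (by fun_prop) (fun θ => (Real.sqrt_pos.2 (hpos θ)).ne')
  · intro θ _
    have h := hpos θ
    rw [le_div_iff₀ (Real.sqrt_pos.2 h)]
    have hx : 0 ≤ k ^ 2 * Real.sin θ ^ 2 := by positivity
    have e : 1 + k ^ 2 / 2 * Real.sin θ ^ 2 = 1 + (k ^ 2 * Real.sin θ ^ 2) / 2 := by ring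
    rw [e]
    generalize k ^ 2 * Real.sin θ ^ 2 = x at *
    have hs := Real.sq_sqrt h.le
    have hs0 := Real.sqrt_nonneg (1 - x)
    refine (sq_le_one_iff₀ (by positivity)).1 ?_
    rw [mul_pow, hs]
    have : (1 + x / 2) ^ 2 * (1 - x) = 1 - 3 / 4 * x ^ 2 - x ^ 3 / 4 := by ring
    rw [this]
    have : 0 ≤ x ^ 2 := by positivity
    have : 0 ≤ x ^ 3 := by positivity
    linarith

theorem frequency_range (k : ℝ) (hk0 : 0 < k) (hk1 : k < 1) :
    ellipticK k ^ 2 * Real.sqrt (k ^ 4 - k ^ 2 + 1) > π ^ 2 / 4 := by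
  have hK := ellipticK_lower k hk0 hk1
  have hm : 0 < k ^ 2 := by positivity
  have hk4 : k ^ 4 - k ^ 2 + 1 = (k ^ 2) ^ 2 - k ^ 2 + 1 := by ring
  rw [hk4]
  generalize k ^ 2 = m at *
  have hs : 1 < (1 + m / 4) ^ 2 * Real.sqrt (m ^ 2 - m + 1) := by
    have h0 : 0 ≤ m ^ 2 - m + 1 := by nlinarith [sq_nonneg (m - 1 / 2)]
    have h1 := Real.sq_sqrt h0
    have h2 := Real.sqrt_nonneg (m ^ 2 - m + 1)
    refine lt_of_pow_lt_pow_left₀ 2 (by positivity) ?_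
    rw [mul_pow, h1]
    have h3 : ((1 + m / 4) ^ 2) ^ 2 ≥ 1 + m + 3 / 8 * m ^ 2 := by
      have : ((1 + m / 4) ^ 2) ^ 2 = 1 + m + 3 / 8 * m ^ 2 + m ^ 3 / 16 + m ^ 4 / 256 := by ring
      rw [this]
      have : 0 < m ^ 3 := by positivity
      have : 0 < m ^ 4 := by positivity
      linarith
    have h4 : (1 + m + 3 / 8 * m ^ 2) * (m ^ 2 - m + 1)
      = 1 + 3 / 8 * m ^ 2 + 5 / 8 * m ^ 3 + 3 / 8 * m ^ 4 := by ring
    have h5 := mul_le_mul_of_nonneg_right h3 h0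
    have : 0 < m ^ 2 := by positivity
    have : 0 < m ^ 3 := by positivity
    have : 0 < m ^ 4 := by positivity
    linarith
  have hK2 : (π / 2 * (1 + m / 4)) ^ 2 ≤ ellipticK k ^ 2 :=
    pow_le_pow_left₀ (by positivity) hK 2
  have h6 := mul_le_mul_of_nonneg_right hK2 (Real.sqrt_nonneg (m ^ 2 - m + 1))
  have h7 := mul_lt_mul_of_pos_left hs (show 0 < π ^ 2 / 4 by positivity)
  have h8 : (π / 2 * (1 + m / 4)) ^ 2 * Real.sqrt (m ^ 2 - m + 1)
    = π ^ 2 / 4 * ((1 + m / 4) ^ 2 * Real.sqrt (m ^ 2 - m + 1)) := by ring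
  linarith
end

section
/- Define, for k ∈ (0,1): r(k) = √(k⁴ − k² + 1), q(k) = k² − 1 − r(k), K(k) = ∫₀^{π/2} (1 − k² sin²θ)^{−1/2} dθ, E(k) = ∫₀^{π/2} √(1 − k² sin²θ) dθ, Π(q,k) = ∫₀^{π/2} ((1 − q sin²θ)·√(1 − k² sin²θ))^{−1} dθ, a(k) = (−12k⁶ + 42k⁴ − 56k² + 32)·r(k) + (12k⁸ − 48k⁶ + 82k⁴ − 72k² + 32), b(k) = (−18k⁴ + 40k² − 32)·r(k) + (18k⁶ − 50k⁴ + 56k² − 32), and G(k) = 4·√(2 − k² + 2r(k)) · ((q(k) − 1)·Π(q(k),k) + K(k)) / q(k). Then for every k ∈ (0,1), G is differentiable at k with G'(k) = (a(k)·K(k) + b(k)·E(k)) / (r(k)·√(2 − k² + 2r(k))·(k² − 1 − r(k))²·k·(1 + r(k))). -/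
open Real

/-- The complete elliptic integral of the second kind. -/
noncomputable def ellipticE (k : ℝ) : ℝ :=
  ∫ θ in (0 : ℝ)..(π / 2), Real.sqrt (1 - k ^ 2 * Real.sin θ ^ 2)

/-- The complete elliptic integral of the third kind. -/
noncomputable def ellipticPi (q k : ℝ) : ℝ :=
  ∫ θ in (0 : ℝ)..(π / 2),
    1 / ((1 - q * Real.sin θ ^ 2) * Real.sqrt (1 - k ^ 2 * Real.sin θ ^ 2))

/-- `r(k) = √(k⁴ − k² + 1)`. -/
noncomputable def rfun (k : ℝ) : ℝ := Real.sqrt (k ^ 4 - k ^ 2 + 1)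

/-- `q(k) = k² − 1 − r(k)`. -/
noncomputable def qfun (k : ℝ) : ℝ := k ^ 2 - 1 - rfun k

/-- `a(k)`, the coefficient of `K(k)` in the derivative numerator. -/
noncomputable def afun (k : ℝ) : ℝ :=
  (-12 * k ^ 6 + 42 * k ^ 4 - 56 * k ^ 2 + 32) * rfun k
    + (12 * k ^ 8 - 48 * k ^ 6 + 82 * k ^ 4 - 72 * k ^ 2 + 32)

/-- `b(k)`, the coefficient of `E(k)` in the derivative numerator. -/
noncomputable def bfun (k : ℝ) : ℝ :=
  (-18 * k ^ 4 + 40 * k ^ 2 - 32) * rfun k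
    + (18 * k ^ 6 - 50 * k ^ 4 + 56 * k ^ 2 - 32)

/-- The squared L² norm (over one period) of the normalized cnoidal wave. -/
noncomputable def Gfun (k : ℝ) : ℝ :=
  4 * Real.sqrt (2 - k ^ 2 + 2 * rfun k) *
    ((qfun k - 1) * ellipticPi (qfun k) k + ellipticK k) / qfun k

open Real Set Filter Topology MeasureTheory

lemma aux_rarg_pos (k : ℝ) : 0 < k ^ 4 - k ^ 2 + 1 := by nlinarith [sq_nonneg (k ^ 2 - 1 / 2)]

lemma rfun_pos (k : ℝ) : 0 < rfun k := Real.sqrt_pos.2 (aux_rarg_pos k)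

lemma rfun_sq (k : ℝ) : rfun k ^ 2 = k ^ 4 - k ^ 2 + 1 := Real.sq_sqrt (aux_rarg_pos k).le

lemma rfun_hasDerivAt (k : ℝ) : HasDerivAt rfun ((2 * k ^ 3 - k) / rfun k) k := by
  have h : HasDerivAt (fun k : ℝ => k ^ 4 - k ^ 2 + 1) (4 * k ^ 3 - 2 * k) k := by
    refine (((hasDerivAt_pow 4 k).sub (hasDerivAt_pow 2 k)).add_const 1).congr_deriv ?_
    norm_num
  have h2 := h.sqrt (aux_rarg_pos k).ne'
  have hr := (rfun_pos k).ne'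
  refine h2.congr_deriv ?_
  change (4 * k ^ 3 - 2 * k) / (2 * rfun k) = _
  field_simp
  ring

lemma rfun_continuous : Continuous rfun :=
  continuous_iff_continuousAt.2 fun k => (rfun_hasDerivAt k).continuousAt

lemma qfun_continuous : Continuous qfun := by
  unfold qfun
  have := rfun_continuous
  fun_prop

lemma qfun_hasDerivAt (k : ℝ) :
    HasDerivAt qfun (2 * k - (2 * k ^ 3 - k) / rfun k) k := by
  refine (((hasDerivAt_pow 2 k).sub_const 1).sub (rfun_hasDerivAt k)).congr_deriv ?_
  norm_num

lemma qfun_neg {k : ℝ} (h0 : 0 < k) (h1 : k < 1) : qfun k < 0 := by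
  have := rfun_pos k
  unfold qfun
  nlinarith

lemma N_pos {k : ℝ} (h0 : 0 < k) (h1 : k < 1) (t : ℝ) : 0 < 1 - qfun k * Real.sin t ^ 2 := by
  have := qfun_neg h0 h1
  nlinarith [sq_nonneg (Real.sin t)]

lemma D_pos {k : ℝ} (h0 : 0 < k) (h1 : k < 1) (t : ℝ) : 0 < 1 - k ^ 2 * Real.sin t ^ 2 := by
  have h2 : k ^ 2 < 1 := by nlinarith
  nlinarith [sq_nonneg (Real.sin t), Real.sin_sq_le_one t, sq_nonneg k]

/-- The integrand after simplification. -/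
noncomputable def hfun (k t : ℝ) : ℝ :=
  (1 - Real.sin t ^ 2) /
    ((1 - qfun k * Real.sin t ^ 2) * Real.sqrt (1 - k ^ 2 * Real.sin t ^ 2))

/-- Its derivative in the modulus. -/
noncomputable def hfun' (k t : ℝ) : ℝ :=
  (1 - Real.sin t ^ 2) *
    ((2 * k - (2 * k ^ 3 - k) / rfun k) * Real.sin t ^ 2 /
      ((1 - qfun k * Real.sin t ^ 2) ^ 2 * Real.sqrt (1 - k ^ 2 * Real.sin t ^ 2))
    + k * Real.sin t ^ 2 /
      ((1 - qfun k * Real.sin t ^ 2) * Real.sqrt (1 - k ^ 2 * Real.sin t ^ 2) ^ 3))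

lemma hfun_hasDerivAt {k : ℝ} (h0 : 0 < k) (h1 : k < 1) (t : ℝ) :
    HasDerivAt (fun k => hfun k t) (hfun' k t) k := by
  have hN := N_pos h0 h1 t
  have hD := D_pos h0 h1 t
  have hS := Real.sqrt_pos.2 hD
  have e1 : HasDerivAt (fun k => 1 - qfun k * Real.sin t ^ 2)
      (-((2 * k - (2 * k ^ 3 - k) / rfun k) * Real.sin t ^ 2)) k :=
    ((qfun_hasDerivAt k).mul_const _).const_sub 1
  have e2 : HasDerivAt (fun k => 1 - k ^ 2 * Real.sin t ^ 2) (-(2 * k * Real.sin t ^ 2)) k := by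
    refine (((hasDerivAt_pow 2 k).mul_const (Real.sin t ^ 2)).const_sub 1).congr_deriv ?_
    norm_num
  have e3 := e2.sqrt hD.ne'
  have e4 := (hasDerivAt_const k (1 - Real.sin t ^ 2)).div (e1.mul e3) (mul_pos hN hS).ne'
  refine e4.congr_deriv ?_
  unfold hfun'
  simp only [Pi.mul_apply]
  have hr := (rfun_pos k).ne'
  generalize (2 * k - (2 * k ^ 3 - k) / rfun k) = q'
  generalize Real.sqrt (1 - k ^ 2 * Real.sin t ^ 2) = S at *
  generalize 1 - qfun k * Real.sin t ^ 2 = N at *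
  field_simp
  ring

lemma hfun_continuous {k : ℝ} (h0 : 0 < k) (h1 : k < 1) : Continuous (hfun k) := by
  unfold hfun
  refine Continuous.div (by fun_prop) (by fun_prop) fun t => ?_
  exact (mul_pos (N_pos h0 h1 t) (Real.sqrt_pos.2 (D_pos h0 h1 t))).ne'

lemma hfun'_continuousOn : ContinuousOn (fun p : ℝ × ℝ => hfun' p.1 p.2) (Ioo 0 1 ×ˢ univ) := by
  have hr := rfun_continuous
  have hq := qfun_continuous
  unfold hfun'
  refine ContinuousOn.mul (by fun_prop) (ContinuousOn.add (ContinuousOn.div ?_ (by fun_prop) ?_)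
    (ContinuousOn.div (by fun_prop) (by fun_prop) ?_))
  · refine ContinuousOn.mul (ContinuousOn.sub (by fun_prop) (ContinuousOn.div (by fun_prop) (by fun_prop) ?_)) (by fun_prop)
    intro p _
    exact (rfun_pos _).ne'
  · rintro ⟨k, t⟩ ⟨⟨h0, h1⟩, _⟩
    exact (mul_pos (pow_pos (N_pos h0 h1 t) 2) (Real.sqrt_pos.2 (D_pos h0 h1 t))).ne'
  · rintro ⟨k, t⟩ ⟨⟨h0, h1⟩, _⟩
    exact (mul_pos (N_pos h0 h1 t) (pow_pos (Real.sqrt_pos.2 (D_pos h0 h1 t)) 3)).ne'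

lemma hfun'_continuous {k : ℝ} (h0 : 0 < k) (h1 : k < 1) : Continuous (hfun' k) := by
  have h : Continuous fun t : ℝ => ((k, t) : ℝ × ℝ) := by fun_prop
  exact hfun'_continuousOn.comp_continuous (f := fun t : ℝ => ((k, t) : ℝ × ℝ)) h fun t => ⟨⟨h0, h1⟩, mem_univ _⟩

lemma J_hasDerivAt {k : ℝ} (h0 : 0 < k) (h1 : k < 1) :
    HasDerivAt (fun k => ∫ t in (0 : ℝ)..(π / 2), hfun k t)
      (∫ t in (0 : ℝ)..(π / 2), hfun' k t) k := by
  have hsub : Icc (k / 2) ((k + 1) / 2) ⊆ Ioo (0 : ℝ) 1 := by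
    intro y hy
    exact ⟨by linarith [hy.1], by linarith [hy.2]⟩
  obtain ⟨C, hC⟩ := (isCompact_Icc (a := k / 2) (b := (k + 1) / 2)).prod
    (isCompact_Icc (a := (0 : ℝ)) (b := π / 2)) |>.exists_bound_of_continuousOn
      (hfun'_continuousOn.mono (prod_mono hsub (subset_univ _)))
  refine (intervalIntegral.hasDerivAt_integral_of_dominated_loc_of_deriv_le
    (s := Icc (k / 2) ((k + 1) / 2)) (bound := fun _ => C)
    (Icc_mem_nhds (by linarith) (by linarith)) ?_ ?_ ?_ ?_ ?_ ?_).2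
  · filter_upwards [Ioo_mem_nhds h0 h1] with y hy
    exact (hfun_continuous hy.1 hy.2).aestronglyMeasurable
  · exact (hfun_continuous h0 h1).intervalIntegrable _ _
  · exact (hfun'_continuous h0 h1).aestronglyMeasurable
  · refine Eventually.of_forall fun t ht x hx => hC (x, t) ⟨hx, ?_⟩
    rw [uIoc_of_le (by positivity)] at ht
    exact ⟨ht.1.le, ht.2⟩
  · simp
  · refine Eventually.of_forall fun t ht x hx => ?_
    exact hfun_hasDerivAt (hsub hx).1 (hsub hx).2 t

lemma K_cont {k : ℝ} (h0 : 0 < k) (h1 : k < 1) :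
    Continuous fun t => 1 / Real.sqrt (1 - k ^ 2 * Real.sin t ^ 2) :=
  Continuous.div (by fun_prop) (by fun_prop) fun t => (Real.sqrt_pos.2 (D_pos h0 h1 t)).ne'

lemma Pi_cont {k : ℝ} (h0 : 0 < k) (h1 : k < 1) :
    Continuous fun t => 1 / ((1 - qfun k * Real.sin t ^ 2) *
      Real.sqrt (1 - k ^ 2 * Real.sin t ^ 2)) :=
  Continuous.div (by fun_prop) (by fun_prop) fun t =>
    (mul_pos (N_pos h0 h1 t) (Real.sqrt_pos.2 (D_pos h0 h1 t))).ne'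

lemma Gfun_eq {k : ℝ} (h0 : 0 < k) (h1 : k < 1) :
    Gfun k = 4 * (Real.sqrt (2 - k ^ 2 + 2 * rfun k) *
      ∫ t in (0 : ℝ)..(π / 2), hfun k t) := by
  have hq := (qfun_neg h0 h1).ne
  have key : (qfun k - 1) * ellipticPi (qfun k) k + ellipticK k
      = qfun k * ∫ t in (0 : ℝ)..(π / 2), hfun k t := by
    unfold ellipticPi ellipticK
    rw [← intervalIntegral.integral_const_mul, ← intervalIntegral.integral_const_mul,
      ← intervalIntegral.integral_add]
    · congr 1
      ext t
      have hN := (N_pos h0 h1 t).ne'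
      have hS := (Real.sqrt_pos.2 (D_pos h0 h1 t)).ne'
      unfold hfun
      field_simp
      ring
    · exact ((Pi_cont h0 h1).const_mul _).intervalIntegrable _ _
    · exact (K_cont h0 h1).intervalIntegrable _ _
  unfold Gfun
  rw [key]
  field_simp

/-- Primitive used for the reduction of the third-kind integral. -/
lemma prim_hasDerivAt {k : ℝ} (h0 : 0 < k) (h1 : k < 1) (α β t : ℝ) :
    HasDerivAt (fun t => Real.sin t * Real.cos t * (α / Real.sqrt (1 - k ^ 2 * Real.sin t ^ 2)
        + β * Real.sqrt (1 - k ^ 2 * Real.sin t ^ 2) / (1 - qfun k * Real.sin t ^ 2)))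
      (α * ((1 - 2 * Real.sin t ^ 2) / Real.sqrt (1 - k ^ 2 * Real.sin t ^ 2)
          + k ^ 2 * (Real.sin t ^ 2 * (1 - Real.sin t ^ 2)) /
            Real.sqrt (1 - k ^ 2 * Real.sin t ^ 2) ^ 3)
        + β * ((1 - 2 * Real.sin t ^ 2) * Real.sqrt (1 - k ^ 2 * Real.sin t ^ 2) /
            (1 - qfun k * Real.sin t ^ 2)
          - k ^ 2 * (Real.sin t ^ 2 * (1 - Real.sin t ^ 2)) /
            (Real.sqrt (1 - k ^ 2 * Real.sin t ^ 2) * (1 - qfun k * Real.sin t ^ 2))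
          + 2 * qfun k * (Real.sin t ^ 2 * (1 - Real.sin t ^ 2)) *
            Real.sqrt (1 - k ^ 2 * Real.sin t ^ 2) / (1 - qfun k * Real.sin t ^ 2) ^ 2)) t := by
  have hN := N_pos h0 h1 t
  have hD := D_pos h0 h1 t
  have hS := Real.sqrt_pos.2 hD
  have s2 : HasDerivAt (fun t => Real.sin t ^ 2) (2 * (Real.sin t * Real.cos t)) t := by
    refine ((Real.hasDerivAt_sin t).pow 2).congr_deriv ?_
    norm_num
    ring
  have sc := (Real.hasDerivAt_sin t).mul (Real.hasDerivAt_cos t)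
  have eN := (s2.const_mul (qfun k)).const_sub 1
  have eS := ((s2.const_mul (k ^ 2)).const_sub 1).sqrt hD.ne'
  have e := sc.mul (((hasDerivAt_const t α).div eS hS.ne').add ((eS.const_mul β).div eN hN.ne'))
  refine e.congr_deriv ?_
  simp only [Pi.mul_apply, Pi.add_apply, Pi.div_apply]
  have hc : Real.cos t ^ 2 = 1 - Real.sin t ^ 2 := by rw [← Real.sin_sq_add_cos_sq t]; ring
  rw [← hc]
  have hc2 : 1 - 2 * Real.sin t ^ 2 = Real.cos t ^ 2 - Real.sin t ^ 2 := by rw [hc]; ring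
  rw [hc2]
  generalize Real.sqrt (1 - k ^ 2 * Real.sin t ^ 2) = S at *
  generalize 1 - qfun k * Real.sin t ^ 2 = N at *
  field_simp
  ring

set_option maxRecDepth 100000 in
set_option maxHeartbeats 4000000 in
lemma alg_identity (k r x : ℝ) (hk : k ≠ 0) (hr : r ≠ 0) (hr1 : 1 + r ≠ 0)
    (hq : k ^ 2 - 1 - r ≠ 0)
    (hN : 1 - (k ^ 2 - 1 - r) * x ≠ 0) (hD : 1 - k ^ 2 * x ≠ 0) (h : r ^ 2 = k ^ 4 - k ^ 2 + 1) :
    4 * ((-k + (2 * k ^ 3 - k) / r) * (1 - x) / (1 - (k ^ 2 - 1 - r) * x)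
      + (2 - k ^ 2 + 2 * r) * ((1 - x) * ((2 * k - (2 * k ^ 3 - k) / r) * x /
          (1 - (k ^ 2 - 1 - r) * x) ^ 2 +
          k * x / ((1 - (k ^ 2 - 1 - r) * x) * (1 - k ^ 2 * x)))))
    = (((-12 * k ^ 6 + 42 * k ^ 4 - 56 * k ^ 2 + 32) * r
        + (12 * k ^ 8 - 48 * k ^ 6 + 82 * k ^ 4 - 72 * k ^ 2 + 32))
      + ((-18 * k ^ 4 + 40 * k ^ 2 - 32) * r
        + (18 * k ^ 6 - 50 * k ^ 4 + 56 * k ^ 2 - 32)) * (1 - k ^ 2 * x)) /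
        (r * (k ^ 2 - 1 - r) ^ 2 * k * (1 + r))
      + (4 * (2 - k ^ 2 + 2 * r) * k / (1 + r) * ((1 - 2 * x)
          + k ^ 2 * (x * (1 - x)) / (1 - k ^ 2 * x))
        + (-2 * (2 - k ^ 2 + 2 * r) * (2 * k - (2 * k ^ 3 - k) / r) / (1 + r)) *
         ((1 - 2 * x) * (1 - k ^ 2 * x) / (1 - (k ^ 2 - 1 - r) * x)
          - k ^ 2 * (x * (1 - x)) / (1 - (k ^ 2 - 1 - r) * x)
          + 2 * (k ^ 2 - 1 - r) * (x * (1 - x)) * (1 - k ^ 2 * x) /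
            (1 - (k ^ 2 - 1 - r) * x) ^ 2)) := by
  have r3 : r ^ 3 = r * (k ^ 4 - k ^ 2 + 1) := by rw [← h]; ring
  have r4 : r ^ 4 = (k ^ 4 - k ^ 2 + 1) ^ 2 := by rw [← h]; ring
  have r5 : r ^ 5 = r * (k ^ 4 - k ^ 2 + 1) ^ 2 := by rw [← h]; ring
  have r6 : r ^ 6 = (k ^ 4 - k ^ 2 + 1) ^ 3 := by rw [← h]; ring
  have r7 : r ^ 7 = r * (k ^ 4 - k ^ 2 + 1) ^ 3 := by rw [← h]; ring
  have r8 : r ^ 8 = (k ^ 4 - k ^ 2 + 1) ^ 4 := by rw [← h]; ring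
  have r9 : r ^ 9 = r * (k ^ 4 - k ^ 2 + 1) ^ 4 := by rw [← h]; ring
  obtain ⟨q, hqq⟩ : ∃ q, q = k ^ 2 - 1 - r := ⟨_, rfl⟩
  rw [← hqq] at hN hq ⊢
  obtain ⟨N, hNN⟩ : ∃ N, N = 1 - q * x := ⟨_, rfl⟩
  obtain ⟨D, hDD⟩ : ∃ D, D = 1 - k ^ 2 * x := ⟨_, rfl⟩
  rw [← hNN] at hN ⊢
  rw [← hDD] at hD ⊢
  field_simp
  rw [← sub_eq_zero]
  subst hNN hDD hqq
  ring_nf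
  simp only [h, r3, r4, r5, r6, r7, r8, r9]
  ring

lemma pointwise {k : ℝ} (h0 : 0 < k) (h1 : k < 1) (t : ℝ) :
    4 * ((-k + (2 * k ^ 3 - k) / rfun k) * hfun k t + (2 - k ^ 2 + 2 * rfun k) * hfun' k t)
    = (afun k / (rfun k * (k ^ 2 - 1 - rfun k) ^ 2 * k * (1 + rfun k))) *
        (1 / Real.sqrt (1 - k ^ 2 * Real.sin t ^ 2))
      + (bfun k / (rfun k * (k ^ 2 - 1 - rfun k) ^ 2 * k * (1 + rfun k))) *
        Real.sqrt (1 - k ^ 2 * Real.sin t ^ 2)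
      + ((4 * (2 - k ^ 2 + 2 * rfun k) * k / (1 + rfun k)) *
        ((1 - 2 * Real.sin t ^ 2) / Real.sqrt (1 - k ^ 2 * Real.sin t ^ 2)
          + k ^ 2 * (Real.sin t ^ 2 * (1 - Real.sin t ^ 2)) /
            Real.sqrt (1 - k ^ 2 * Real.sin t ^ 2) ^ 3)
        + (-2 * (2 - k ^ 2 + 2 * rfun k) * (2 * k - (2 * k ^ 3 - k) / rfun k) / (1 + rfun k)) *
         ((1 - 2 * Real.sin t ^ 2) * Real.sqrt (1 - k ^ 2 * Real.sin t ^ 2) /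
            (1 - qfun k * Real.sin t ^ 2)
          - k ^ 2 * (Real.sin t ^ 2 * (1 - Real.sin t ^ 2)) /
            (Real.sqrt (1 - k ^ 2 * Real.sin t ^ 2) * (1 - qfun k * Real.sin t ^ 2))
          + 2 * qfun k * (Real.sin t ^ 2 * (1 - Real.sin t ^ 2)) *
            Real.sqrt (1 - k ^ 2 * Real.sin t ^ 2) / (1 - qfun k * Real.sin t ^ 2) ^ 2)) := by
  have hN := (N_pos h0 h1 t).ne'
  have hD := D_pos h0 h1 t
  have hS := (Real.sqrt_pos.2 hD).ne'
  have hr := rfun_pos k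
  have hq := (qfun_neg h0 h1).ne
  have hS2 := Real.sq_sqrt hD.le
  have key := alg_identity k (rfun k) (Real.sin t ^ 2) h0.ne' hr.ne' (by positivity) hq
    hN hD.ne' (rfun_sq k)
  unfold hfun hfun' afun bfun
  change _ = _ at key
  rw [show k ^ 2 - 1 - rfun k = qfun k from rfl] at key ⊢
  generalize (2 * k - (2 * k ^ 3 - k) / rfun k) = q' at *
  generalize (-k + (2 * k ^ 3 - k) / rfun k) = w' at *
  generalize (-12 * k ^ 6 + 42 * k ^ 4 - 56 * k ^ 2 + 32) * rfun k
    + (12 * k ^ 8 - 48 * k ^ 6 + 82 * k ^ 4 - 72 * k ^ 2 + 32) = a at *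
  generalize (-18 * k ^ 4 + 40 * k ^ 2 - 32) * rfun k
    + (18 * k ^ 6 - 50 * k ^ 4 + 56 * k ^ 2 - 32) = b at *
  generalize 4 * (2 - k ^ 2 + 2 * rfun k) * k / (1 + rfun k) = α at *
  generalize -2 * (2 - k ^ 2 + 2 * rfun k) * q' / (1 + rfun k) = β at *
  generalize (rfun k * qfun k ^ 2 * k * (1 + rfun k)) = M at *
  generalize 2 - k ^ 2 + 2 * rfun k = w at *
  generalize Real.sqrt (1 - k ^ 2 * Real.sin t ^ 2) = S at *
  rw [← hS2] at key
  generalize 1 - qfun k * Real.sin t ^ 2 = N at *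
  generalize Real.sin t ^ 2 = x at *
  trans (1 / S) * (4 * (w' * (1 - x) / N + w * ((1 - x) * (q' * x / N ^ 2 + k * x / (N * S ^ 2)))))
  · field_simp
  · rw [key]
    simp only [div_eq_mul_inv, mul_inv]
    field_simp

theorem G_hasDerivAt (k : ℝ) (hk0 : 0 < k) (hk1 : k < 1) :
    HasDerivAt Gfun
      ((afun k * ellipticK k + bfun k * ellipticE k) /
        (rfun k * Real.sqrt (2 - k ^ 2 + 2 * rfun k) *
          (k ^ 2 - 1 - rfun k) ^ 2 * k * (1 + rfun k))) k := by
  have hr := rfun_pos k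
  have hq : k ^ 2 - 1 - rfun k ≠ 0 := (qfun_neg hk0 hk1).ne
  have hw : 0 < 2 - k ^ 2 + 2 * rfun k := by nlinarith
  have hW := Real.sqrt_pos.2 hw
  have hW2 := Real.sq_sqrt hw.le
  have ew : HasDerivAt (fun k => 2 - k ^ 2 + 2 * rfun k)
      (2 * (-k + (2 * k ^ 3 - k) / rfun k)) k := by
    refine (((hasDerivAt_pow 2 k).const_sub 2).add
      ((rfun_hasDerivAt k).const_mul 2)).congr_deriv ?_
    norm_num
    ring
  have eG := ((ew.sqrt hw.ne').mul (J_hasDerivAt hk0 hk1)).const_mul 4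
  have eG2 : HasDerivAt Gfun _ k := eG.congr_of_eventuallyEq (by
    filter_upwards [Ioo_mem_nhds hk0 hk1] with y hy
    exact Gfun_eq hy.1 hy.2)
  refine eG2.congr_deriv ?_
  have hh := (hfun_continuous hk0 hk1).intervalIntegrable (μ := volume) 0 (π / 2)
  have hh' := (hfun'_continuous hk0 hk1).intervalIntegrable (μ := volume) 0 (π / 2)
  have hK := (K_cont hk0 hk1).intervalIntegrable (μ := volume) 0 (π / 2)
  have hE : IntervalIntegrable (fun t => Real.sqrt (1 - k ^ 2 * Real.sin t ^ 2)) volume 0 (π / 2) :=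
    Continuous.intervalIntegrable (by fun_prop) _ _
  set A := afun k / (rfun k * (k ^ 2 - 1 - rfun k) ^ 2 * k * (1 + rfun k)) with hA
  set B := bfun k / (rfun k * (k ^ 2 - 1 - rfun k) ^ 2 * k * (1 + rfun k)) with hB
  have main : 4 * ((-k + (2 * k ^ 3 - k) / rfun k) * (∫ t in (0 : ℝ)..(π / 2), hfun k t)
      + (2 - k ^ 2 + 2 * rfun k) * (∫ t in (0 : ℝ)..(π / 2), hfun' k t))
      - (A * ellipticK k + B * ellipticE k) = 0 := by
    unfold ellipticK ellipticE
    rw [← intervalIntegral.integral_const_mul, ← intervalIntegral.integral_const_mul,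
      ← intervalIntegral.integral_const_mul, ← intervalIntegral.integral_const_mul,
      ← intervalIntegral.integral_add (hh.const_mul _) (hh'.const_mul _),
      ← intervalIntegral.integral_add (hK.const_mul _) (hE.const_mul _),
      ← intervalIntegral.integral_const_mul,
      ← intervalIntegral.integral_sub (((hh.const_mul _).add (hh'.const_mul _)).const_mul _)
        ((hK.const_mul _).add (hE.const_mul _))]
    rw [intervalIntegral.integral_eq_sub_of_hasDerivAt (fun t _ =>
      (prim_hasDerivAt hk0 hk1 (4 * (2 - k ^ 2 + 2 * rfun k) * k / (1 + rfun k))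
        (-2 * (2 - k ^ 2 + 2 * rfun k) * (2 * k - (2 * k ^ 3 - k) / rfun k) / (1 + rfun k))
        t).congr_deriv (eq_sub_of_add_eq' (pointwise hk0 hk1 t).symm))
      ((((hh.const_mul _).add (hh'.const_mul _)).const_mul _).sub
        ((hK.const_mul _).add (hE.const_mul _)))]
    simp
  generalize (∫ t in (0 : ℝ)..(π / 2), hfun k t) = I at *
  generalize (∫ t in (0 : ℝ)..(π / 2), hfun' k t) = I' at *
  have hrhs : (afun k * ellipticK k + bfun k * ellipticE k) /
        (rfun k * Real.sqrt (2 - k ^ 2 + 2 * rfun k) *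
          (k ^ 2 - 1 - rfun k) ^ 2 * k * (1 + rfun k))
      = (A * ellipticK k + B * ellipticE k) / Real.sqrt (2 - k ^ 2 + 2 * rfun k) := by
    rw [hA, hB]
    field_simp
  rw [hrhs, ← sub_eq_zero.1 main]
  generalize (-k + (2 * k ^ 3 - k) / rfun k) = w' at *
  generalize Real.sqrt (2 - k ^ 2 + 2 * rfun k) = W at *
  rw [← hW2]
  field_simp
end
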